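/- arXiv:2202.07337 — 4 statements merged into one kernel-verified Lean document; each statement's English description precedes it below -/
import Mathlib

section
/- Let T be a nonempty metric space, (T_n) a sequence of nonempty metric spaces, and (M_n) a sequence of positive real numbers such that dGH(T, T_n) < M_n for every n and T is not isometric to T_n for any n. Then there exist a metric space Z and isometric embeddings ι : T → Z and ι_n : T_n → Z for every n such that the Hausdorff distance in Z between ι(T) and ι_n(T_n) is strictly less than M_n for every n. -/
set_option linter.unusedVariables false
set_option linter.unreachableTactic false
set_option linter.unusedTactic false

open scoped ENNReal

/-- A correspondence between `X` and `Y`: a relation such that every point of `X`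
is related to some point of `Y` and vice versa. -/
def IsCorrespondence {X Y : Type*} (R : Set (X × Y)) : Prop :=
  (∀ x : X, ∃ y : Y, (x, y) ∈ R) ∧ (∀ y : Y, ∃ x : X, (x, y) ∈ R)

/-- The distortion of a relation `R ⊆ X × Y`:
`sup {|dist x x' - dist y y'| : (x,y), (x',y') ∈ R}`, in `[0,∞]`. -/
noncomputable def distortion {X Y : Type*} [MetricSpace X] [MetricSpace Y]
    (R : Set (X × Y)) : ℝ≥0∞ :=
  ⨆ p ∈ R, ⨆ q ∈ R, ENNReal.ofReal |dist p.1 q.1 - dist p.2 q.2|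

/-- The Gromov–Hausdorff distance between two metric spaces: half the infimum of the
distortions of all correspondences between them, in `[0,∞]`. -/
noncomputable def GHDist (X Y : Type*) [MetricSpace X] [MetricSpace Y] : ℝ≥0∞ :=
  (⨅ R : {R : Set (X × Y) // IsCorrespondence R}, distortion R.1) / 2

/-- The distance function of an explicitly given metric-space structure. -/
noncomputable def mdist {Z : Type*} (mZ : MetricSpace Z) (a b : Z) : ℝ :=
  @dist Z mZ.toPseudoMetricSpace.toDist a b

/-- Two (explicitly given) metric-space structures are isometric: there is a
distance-preserving bijection between them. -/
def IsometricM {X Y : Type*} (mX : MetricSpace X) (mY : MetricSpace Y) : Prop :=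
  ∃ f : X ≃ Y, ∀ a b : X,
    @dist Y mY.toPseudoMetricSpace.toDist (f a) (f b) =
      @dist X mX.toPseudoMetricSpace.toDist a b

universe u

namespace FamilyGluing

variable {I T : Type*} {G : I → Type*} [∀ i, PseudoMetricSpace (G i)]

open Classical in
/-- The distance on the disjoint union of the spaces `G i` after gluing them along the
images of a common space `T`. -/
noncomputable def glueDist (Φ : ∀ i, T → G i) (p q : Σ i, G i) : ℝ :=
  if h : p.1 = q.1 then dist (h ▸ p.2) q.2
  else ⨅ t, (dist p.2 (Φ p.1 t) + dist q.2 (Φ q.1 t))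

theorem glueDist_same (Φ : ∀ i, T → G i) (i : I) (x y : G i) :
    glueDist Φ ⟨i, x⟩ ⟨i, y⟩ = dist x y := by
  simp [glueDist]

theorem glueDist_of_ne (Φ : ∀ i, T → G i) {i j : I} (h : i ≠ j) (x : G i) (y : G j) :
    glueDist Φ ⟨i, x⟩ ⟨j, y⟩ = ⨅ t, (dist x (Φ i t) + dist y (Φ j t)) := by
  simp [glueDist, h]

theorem glueDist_comm (Φ : ∀ i, T → G i) (p q : Σ i, G i) :
    glueDist Φ p q = glueDist Φ q p := by
  obtain ⟨i, x⟩ := p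
  obtain ⟨j, y⟩ := q
  by_cases h : i = j
  · subst h
    simp only [glueDist_same, dist_comm]
  · simp only [glueDist_of_ne Φ h, glueDist_of_ne Φ (Ne.symm h), add_comm]

variable [MetricSpace T] {Φ : ∀ i, T → G i}

theorem glueDist_le (hΦ : ∀ i, Isometry (Φ i)) {i j : I} (x : G i) (y : G j) (s t : T) :
    glueDist Φ ⟨i, x⟩ ⟨j, y⟩ ≤ dist x (Φ i s) + dist s t + dist y (Φ j t) := by
  by_cases h : i = j
  · subst h
    rw [glueDist_same, ← (hΦ i).dist_eq s t, dist_comm y]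
    exact dist_triangle4 _ _ _ _
  · rw [glueDist_of_ne Φ h]
    have hbdd : BddBelow (Set.range fun t => dist x (Φ i t) + dist y (Φ j t)) :=
      ⟨0, by rintro _ ⟨t, rfl⟩; positivity⟩
    have htri := dist_triangle x (Φ i s) (Φ i t)
    rw [(hΦ i).dist_eq] at htri
    exact (ciInf_le hbdd t).trans (by linarith)

variable [Nonempty T]

theorem glueDist_triangle_of_same (hΦ : ∀ i, Isometry (Φ i)) {i : I} (x y : G i)
    (r : Σ i, G i) : glueDist Φ ⟨i, x⟩ r ≤ dist x y + glueDist Φ ⟨i, y⟩ r := by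
  obtain ⟨k, z⟩ := r
  by_cases h : i = k
  · subst h
    simpa only [glueDist_same] using dist_triangle x y z
  · rw [glueDist_of_ne Φ h y, ← sub_le_iff_le_add']
    refine le_ciInf fun t => ?_
    have hle := glueDist_le hΦ x z t t
    rw [dist_self] at hle
    linarith [dist_triangle x y (Φ i t)]

theorem glueDist_triangle (hΦ : ∀ i, Isometry (Φ i)) (p q r : Σ i, G i) :
    glueDist Φ p r ≤ glueDist Φ p q + glueDist Φ q r := by
  obtain ⟨i, x⟩ := p
  obtain ⟨j, y⟩ := q
  obtain ⟨k, z⟩ := r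
  by_cases hij : i = j
  · subst hij
    rw [glueDist_same]
    exact glueDist_triangle_of_same hΦ x y _
  by_cases hjk : j = k
  · subst hjk
    rw [glueDist_same, add_comm, dist_comm, glueDist_comm, glueDist_comm Φ ⟨i, x⟩]
    exact glueDist_triangle_of_same hΦ z y _
  rw [glueDist_of_ne Φ hij, glueDist_of_ne Φ hjk, ← sub_le_iff_le_add]
  refine le_ciInf fun s => ?_
  rw [sub_le_comm]
  refine le_ciInf fun t => ?_
  have htri := dist_triangle_left (Φ j s) (Φ j t) y
  rw [(hΦ j).dist_eq] at htri
  linarith [glueDist_le hΦ x z s t]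

/-- The disjoint union of the spaces `G i`, carrying the pseudometric that glues them
along `T`. -/
def GlueSpace (_ : ∀ i, Isometry (Φ i)) := Σ i, G i

noncomputable instance (hΦ : ∀ i, Isometry (Φ i)) : PseudoMetricSpace (GlueSpace hΦ) where
  dist := glueDist Φ
  dist_self p := (glueDist_same Φ p.1 p.2 p.2).trans (dist_self _)
  dist_comm := glueDist_comm Φ
  dist_triangle := glueDist_triangle hΦ

/-- The canonical map of `G i` into the metric space obtained by gluing along `T`. -/
noncomputable def toGlueSpace (hΦ : ∀ i, Isometry (Φ i)) (i : I) (x : G i) :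
    SeparationQuotient (GlueSpace hΦ) :=
  SeparationQuotient.mk (X := GlueSpace hΦ) ⟨i, x⟩

theorem isometry_toGlueSpace (hΦ : ∀ i, Isometry (Φ i)) (i : I) :
    Isometry (toGlueSpace hΦ i) :=
  Isometry.of_dist_eq fun x y => glueDist_same Φ i x y

theorem toGlueSpace_apply_eq (hΦ : ∀ i, Isometry (Φ i)) (i j : I) (t : T) :
    toGlueSpace hΦ i (Φ i t) = toGlueSpace hΦ j (Φ j t) := by
  refine dist_le_zero.1 ((glueDist_le hΦ (Φ i t) (Φ j t) t t).trans ?_)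
  simp

end FamilyGluing

theorem abs_dist_sub_dist_le_of_distortion_le {X Y : Type*} [MetricSpace X] [MetricSpace Y]
    {R : Set (X × Y)} {c : ℝ} (hc : 0 ≤ c) (h : distortion R ≤ ENNReal.ofReal c)
    {p q : X × Y} (hp : p ∈ R) (hq : q ∈ R) :
    |dist p.1 q.1 - dist p.2 q.2| ≤ c := by
  rw [← ENNReal.ofReal_le_ofReal_iff hc]
  refine le_trans ?_ h
  exact le_iSup₂_of_le p hp (le_iSup₂_of_le q hq le_rfl)

/-- If `GHDist X Y < M`, some correspondence has distortion at most `2 * r` for some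
positive `r < M`. -/
theorem exists_correspondence_of_GHDist_lt {X Y : Type*} [MetricSpace X] [MetricSpace Y]
    {M : ℝ} (hM : 0 < M) (h : GHDist X Y < ENNReal.ofReal M) :
    ∃ (R : Set (X × Y)) (r : ℝ), IsCorrespondence R ∧ 0 < r ∧ r < M ∧
      ∀ p ∈ R, ∀ q ∈ R, |dist p.1 q.1 - dist p.2 q.2| ≤ 2 * r := by
  rw [GHDist, ENNReal.div_lt_iff (by simp) (by simp), iInf_lt_iff] at h
  obtain ⟨⟨R, hR⟩, hlt⟩ := h
  have hfin : distortion R ≠ ⊤ := (hlt.trans (by finiteness)).ne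
  have hlt' : (distortion R).toReal < M * 2 := by
    rw [← ENNReal.ofReal_lt_ofReal_iff (by positivity), ENNReal.ofReal_toReal hfin,
      ENNReal.ofReal_mul hM.le]
    simpa using hlt
  obtain ⟨c, hc, hcM⟩ := exists_between hlt'
  have hc0 : 0 < c := ENNReal.toReal_nonneg.trans_lt hc
  refine ⟨R, c / 2, hR, by linarith, by linarith, fun p hp q hq => ?_⟩
  rw [mul_div_cancel₀ c two_ne_zero]
  exact abs_dist_sub_dist_le_of_distortion_le hc0.le
    (ENNReal.le_ofReal_iff_toReal_le hfin hc0.le |>.2 hc.le) hp hq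

/-- Two spaces with `GHDist X Y < M` embed in a common metric space, with every point of
either one within some `r < M` of the other. -/
theorem exists_metric_sum_of_GHDist_lt {X Y : Type*} [MetricSpace X] [MetricSpace Y]
    [Nonempty X] {M : ℝ} (hM : 0 < M) (h : GHDist X Y < ENNReal.ofReal M) :
    ∃ (m : MetricSpace (X ⊕ Y)) (r : ℝ), 0 < r ∧ r < M ∧
      (∀ a b : X, mdist m (.inl a) (.inl b) = dist a b) ∧
      (∀ a b : Y, mdist m (.inr a) (.inr b) = dist a b) ∧
      (∀ x : X, ∃ y : Y, mdist m (.inl x) (.inr y) ≤ r) ∧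
      (∀ y : Y, ∃ x : X, mdist m (.inl x) (.inr y) ≤ r) := by
  obtain ⟨R, r, ⟨hRl, hRr⟩, hr, hrM, hdis⟩ := exists_correspondence_of_GHDist_lt hM h
  obtain ⟨x₀⟩ := ‹Nonempty X›
  obtain ⟨y₀, h₀⟩ := hRl x₀
  have : Nonempty R := ⟨⟨_, h₀⟩⟩
  refine ⟨Metric.glueMetricApprox (fun p : R => p.1.1) (fun p : R => p.1.2) r hr
    fun p q => hdis p p.2 q q.2, r, hr, hrM, fun _ _ => rfl, fun _ _ => rfl,
    fun x => ?_, fun y => ?_⟩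
  · obtain ⟨y, hy⟩ := hRl x
    exact ⟨y, (Metric.glueDist_glued_points (fun p : R => p.1.1) (fun p : R => p.1.2) r
      ⟨_, hy⟩).le⟩
  · obtain ⟨x, hx⟩ := hRr y
    exact ⟨x, (Metric.glueDist_glued_points (fun p : R => p.1.1) (fun p : R => p.1.2) r
      ⟨_, hx⟩).le⟩

/-- Collective isometric embedding: if `dGH(T, Tₙ) < Mₙ` and `T` is not isometric to
any `Tₙ`, then all the spaces embed isometrically in a single metric space `Z` so that
the Hausdorff distance between (the copies of) `T` and `Tₙ` is `< Mₙ`. -/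
theorem collective_isometric_embedding {T : Type u} [mT : MetricSpace T] [Nonempty T]
    (Tn : ℕ → Type u) (mTn : ∀ n, MetricSpace (Tn n)) (hne : ∀ n, Nonempty (Tn n))
    (M : ℕ → ℝ) (hM : ∀ n, 0 < M n)
    (hGH : ∀ n, @GHDist T (Tn n) mT (mTn n) < ENNReal.ofReal (M n))
    (hniso : ∀ n, ¬ IsometricM mT (mTn n)) :
    ∃ (Z : Type u) (mZ : MetricSpace Z) (ι : T → Z) (ιn : ∀ n, Tn n → Z),
      (∀ a b : T, mdist mZ (ι a) (ι b) = dist a b) ∧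
      (∀ n, ∀ a b : Tn n, mdist mZ (ιn n a) (ιn n b) = mdist (mTn n) a b) ∧
      (∀ n, @Metric.hausdorffDist Z mZ.toPseudoMetricSpace
        (Set.range ι) (Set.range (ιn n)) < M n) := by
  choose m r hr hrM hl hrr hlr hrl using fun n =>
    @exists_metric_sum_of_GHDist_lt T (Tn n) mT (mTn n) _ (M n) (hM n) (hGH n)
  let Φ : ∀ n, T → T ⊕ Tn n := fun n => .inl
  have hΦ : ∀ n, Isometry (Φ n) := fun n => Isometry.of_dist_eq (hl n)
  have hι := FamilyGluing.isometry_toGlueSpace hΦ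
  let ι := fun t => FamilyGluing.toGlueSpace hΦ 0 (.inl t)
  let ιn := fun n x => FamilyGluing.toGlueSpace hΦ n (.inr x)
  have hdist : ∀ n t x, dist (ι t) (ιn n x) = mdist (m n) (.inl t) (.inr x) := fun n t x => by
    rw [show ι t = _ from FamilyGluing.toGlueSpace_apply_eq hΦ 0 n t]
    exact (hι n).dist_eq _ _
  refine ⟨SeparationQuotient (FamilyGluing.GlueSpace hΦ), inferInstance, ι, ιn,
    fun a b => ((hι 0).dist_eq _ _).trans (hl 0 a b),
    fun n a b => ((hι n).dist_eq _ _).trans (hrr n a b), fun n => ?_⟩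
  refine (Metric.hausdorffDist_le_of_mem_dist (hr n).le ?_ ?_).trans_lt (hrM n)
  · rintro _ ⟨t, rfl⟩
    obtain ⟨x, hx⟩ := hlr n t
    exact ⟨_, ⟨x, rfl⟩, (hdist n t x).trans_le hx⟩
  · rintro _ ⟨x, rfl⟩
    obtain ⟨t, ht⟩ := hrl n x
    exact ⟨_, ⟨t, rfl⟩, (dist_comm _ _).trans_le ((hdist n t x).trans_le ht)⟩
end

section
/- Let H be a subgroup of the multiplicative group of positive real numbers with H ≠ {1}. Then the set { λ > 0 : the hedgehog over the set λH = {λh : h ∈ H} is isometric to the hedgehog Ĥ } is exactly H. -/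
set_option linter.unusedVariables false
set_option linter.unreachableTactic false
set_option linter.unusedTactic false

open Classical in
/-- The hedgehog distance on `Option A` for a needle-length function `f : A → ℝ`:
the distance between distinct needle tips `a, b` is `f a + f b`, and the distance
from the center `none` to a needle tip `a` is `f a`. -/
noncomputable def hedgehogDist {A : Type*} (f : A → ℝ) : Option A → Option A → ℝ
  | none, none => 0
  | none, some a => f a
  | some a, none => f a
  | some a, some b => if a = b then 0 else f a + f b

/-- The hedgehog over `(A, f)` (a hedgehog over a set of needle lengths with
multiplicities): the metric space on `A ∪ {0}` (encoded as `Option A`) with the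
hedgehog distance. -/
noncomputable def hedgehog {A : Type*} (f : A → ℝ) (hf : ∀ a, 0 < f a) :
    MetricSpace (Option A) :=
  { dist := hedgehogDist f
    dist_self := fun a => by
      cases a with
      | none => rfl
      | some a => simp [hedgehogDist]
    dist_comm := fun a b => by
      cases a <;> cases b <;> simp only [hedgehogDist]
      rename_i a b
      by_cases h : a = b
      · simp [h]
      · rw [if_neg h, if_neg (Ne.symm h), add_comm]
    dist_triangle := fun x y z => by
      rcases x with _ | a <;> rcases y with _ | b <;> rcases z with _ | c <;>
        simp only [hedgehogDist]
      · linarith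
      · linarith [(hf c).le]
      · linarith [(hf b).le]
      · have pb := (hf b).le; have pc := (hf c).le
        split_ifs <;> try subst_vars
        all_goals first | linarith | simp_all
      · linarith
      · have pa := (hf a).le; have pc := (hf c).le
        split_ifs <;> try subst_vars
        all_goals first | linarith | simp_all
      · have pa := (hf a).le; have pb := (hf b).le
        split_ifs <;> try subst_vars
        all_goals first | linarith | simp_all
      · have pa := (hf a).le; have pb := (hf b).le; have pc := (hf c).le
        split_ifs <;> try subst_vars
        all_goals first | linarith | simp_all
    eq_of_dist_eq_zero := fun {a b} h0 => by
      rcases a with _ | a <;> rcases b with _ | b <;> simp only [hedgehogDist] at h0 ⊢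
      · exact absurd h0 (hf _).ne'
      · exact absurd h0 (hf _).ne'
      · by_cases h : a = b
        · simp [h]
        · rw [if_neg h] at h0
          have := hf a; have := hf b
          exact absurd h0 (by linarith) }

/-- The hedgehog over a set `X ⊆ (0,∞)` of needle lengths. -/
noncomputable def hedgehogSet (X : Set ℝ) (hX : X ⊆ Set.Ioi 0) :
    MetricSpace (Option ↥X) :=
  hedgehog (fun x : X => (x : ℝ)) (fun x => hX x.2)

lemma scaled_subset {X : Set ℝ} (hX : X ⊆ Set.Ioi 0) {lam : ℝ} (hlam : 0 < lam) :
    (fun x => lam * x) '' X ⊆ Set.Ioi 0 := by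
  rintro y ⟨x, hx, rfl⟩
  exact mul_pos hlam (hX hx)

/-- A distance-preserving bijection between hedgehogs over sets sends the center to the
center as soon as the target hedgehog has at least three needles. -/
lemma hedgehogSet_map_center {X Y : Set ℝ} (hY : Y ⊆ Set.Ioi 0)
    (h3 : ∀ x : ℝ, ∃ y ∈ Y, ∃ z ∈ Y, y ≠ x ∧ z ≠ x ∧ y ≠ z)
    (f : Option X ≃ Option Y)
    (hf : ∀ a b, hedgehogDist (fun y : Y => (y : ℝ)) (f a) (f b) =
      hedgehogDist (fun x : X => (x : ℝ)) a b) :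
    f none = none := by
  by_contra hne
  obtain ⟨x, hx⟩ := Option.ne_none_iff_exists'.mp hne
  obtain ⟨y, hy, z, hz, hyx, hzx, hyz⟩ := h3 x
  have preimage_tip : ∀ w : Y, (w : ℝ) ≠ x → ∃ a : X, f (some a) = some w := by
    intro w hw
    cases h : f.symm (some w) with
    | none =>
      rw [Equiv.symm_apply_eq, hx, Option.some.injEq] at h
      exact absurd (congrArg Subtype.val h) hw
    | some a => exact ⟨a, ((Equiv.symm_apply_eq f).mp h).symm⟩
  obtain ⟨a, ha⟩ := preimage_tip ⟨y, hy⟩ hyx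
  obtain ⟨b, hb⟩ := preimage_tip ⟨z, hz⟩ hzx
  have hab : a ≠ b := by
    rintro rfl
    rw [ha, Option.some.injEq, Subtype.mk.injEq] at hb
    exact hyz hb
  have h1 := hf (some a) (some b)
  have h2 := hf (some a) none
  have h4 := hf none (some b)
  have hyx' : (⟨y, hy⟩ : Y) ≠ x := fun h => hyx (congrArg Subtype.val h)
  have hxz' : x ≠ (⟨z, hz⟩ : Y) := fun h => hzx (congrArg Subtype.val h).symm
  have hyz' : (⟨y, hy⟩ : Y) ≠ ⟨z, hz⟩ := fun h => hyz (congrArg Subtype.val h)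
  rw [ha, hb] at h1
  rw [ha, hx] at h2
  rw [hb, hx] at h4
  simp only [hedgehogDist, if_neg hab, if_neg hyx', if_neg hxz', if_neg hyz'] at h1 h2 h4
  have hxpos : (0 : ℝ) < x := hY x.2
  linarith

/-- Hedgehogs over sets of needle lengths are isometric only if the sets agree, provided the
second one has at least three elements. -/
lemma eq_of_isometricM_hedgehogSet {X Y : Set ℝ} (hX : X ⊆ Set.Ioi 0) (hY : Y ⊆ Set.Ioi 0)
    (h3 : ∀ x : ℝ, ∃ y ∈ Y, ∃ z ∈ Y, y ≠ x ∧ z ≠ x ∧ y ≠ z)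
    (h : IsometricM (hedgehogSet X hX) (hedgehogSet Y hY)) : X = Y := by
  obtain ⟨f, hf⟩ := h
  replace hf : ∀ a b, hedgehogDist (fun y : Y => (y : ℝ)) (f a) (f b) =
      hedgehogDist (fun x : X => (x : ℝ)) a b := hf
  have hcenter := hedgehogSet_map_center hY h3 f hf
  have length_eq : ∀ (x : X) (y : Y), f (some x) = some y → (y : ℝ) = x := by
    intro x y hxy
    have := hf none (some x)
    rwa [hcenter, hxy] at this
  ext t
  constructor
  · intro ht
    cases h : f (some ⟨t, ht⟩) with
    | none => exact absurd (f.injective (h.trans hcenter.symm)) (Option.some_ne_none _)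
    | some y =>
      have hyt : (y : ℝ) = t := length_eq _ _ h
      exact hyt ▸ y.2
  · intro ht
    cases h : f.symm (some ⟨t, ht⟩) with
    | none =>
      rw [Equiv.symm_apply_eq, hcenter] at h
      exact absurd h (Option.some_ne_none _)
    | some x =>
      have hxt : t = x := length_eq _ _ ((Equiv.symm_apply_eq f).mp h).symm
      exact hxt ▸ x.2

lemma isometricM_hedgehogSet_of_eq {X Y : Set ℝ} (hX : X ⊆ Set.Ioi 0) (hY : Y ⊆ Set.Ioi 0)
    (h : X = Y) : IsometricM (hedgehogSet X hX) (hedgehogSet Y hY) := by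
  subst h
  exact ⟨Equiv.refl _, fun _ _ => rfl⟩

/-- Outside any given point, a nontrivial multiplicative group of positive reals has two
distinct elements. -/
lemma exists_pair_ne_of_nontrivial {H : Set ℝ} (hpos : H ⊆ Set.Ioi 0) (hone : (1 : ℝ) ∈ H)
    (hinv : ∀ a ∈ H, a⁻¹ ∈ H) (hnontriv : H ≠ {1}) (x : ℝ) :
    ∃ y ∈ H, ∃ z ∈ H, y ≠ x ∧ z ≠ x ∧ y ≠ z := by
  obtain ⟨h, hH, h1⟩ : ∃ h ∈ H, h ≠ 1 := by
    by_contra! hall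
    exact hnontriv (Set.eq_singleton_iff_unique_mem.mpr ⟨hone, hall⟩)
  have hh : 0 < h := hpos hH
  have hi1 : h⁻¹ ≠ 1 := fun e => h1 (inv_eq_one.mp e)
  have hhi : h ≠ h⁻¹ := by
    intro e
    have hsq : h * h = 1 := by
      nth_rewrite 2 [e]
      exact mul_inv_cancel₀ hh.ne'
    exact h1 (by nlinarith)
  by_cases hx1 : x = 1
  · subst hx1
    exact ⟨h, hH, h⁻¹, hinv h hH, h1, hi1, hhi⟩
  by_cases hxh : x = h
  · subst hxh
    exact ⟨1, hone, x⁻¹, hinv x hH, h1.symm, hhi.symm, hi1.symm⟩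
  · exact ⟨1, hone, h, hH, Ne.symm hx1, Ne.symm hxh, h1.symm⟩

/-- For a nontrivial subgroup `H` of the multiplicative group of positive reals, the
set of `λ > 0` such that the hedgehog over `λH` is isometric to the hedgehog over `H`
is exactly `H`. -/
theorem hedgehog_stabilizer_of_subgroup (H : Set ℝ) (hpos : H ⊆ Set.Ioi 0)
    (hone : (1 : ℝ) ∈ H) (hmul : ∀ a ∈ H, ∀ b ∈ H, a * b ∈ H)
    (hinv : ∀ a ∈ H, a⁻¹ ∈ H) (hnontriv : H ≠ {1}) :
    {lam : ℝ | ∃ hlam : 0 < lam,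
      IsometricM (hedgehogSet ((fun x => lam * x) '' H) (scaled_subset hpos hlam))
        (hedgehogSet H hpos)} = H := by
  ext lam
  constructor
  · rintro ⟨hlam, hiso⟩
    have heq := eq_of_isometricM_hedgehogSet _ hpos
      (exists_pair_ne_of_nontrivial hpos hone hinv hnontriv) hiso
    exact heq ▸ ⟨1, hone, mul_one lam⟩
  · intro hlamH
    have hlam : 0 < lam := hpos hlamH
    refine ⟨hlam, isometricM_hedgehogSet_of_eq _ _ (Set.Subset.antisymm ?_ ?_)⟩
    · rintro _ ⟨x, hx, rfl⟩
      exact hmul lam hlamH x hx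
    · intro x hx
      exact ⟨lam⁻¹ * x, hmul _ (hinv lam hlamH) x hx, mul_inv_cancel_left₀ hlam.ne' x⟩
end

section
/- Let T be a nonempty complete metric space and X ⊆ (0,∞) a nonempty subset such that dGH(T, X̂) = 0. Then there exist a set A and a function f : A → (0,∞) whose range is contained in the closure of X in ℝ, such that T is isometric to the hedgehog over (A, f). -/
set_option linter.unusedVariables false
set_option linter.unreachableTactic false
set_option linter.unusedTactic false

open scoped ENNReal

universe u

/-- Metric spaces at zero Gromov–Hausdorff distance admit correspondences of arbitrarily small
distortion. -/
theorem exists_correspondence_of_GHDist_eq_zero {X Y : Type*} [MetricSpace X] [MetricSpace Y]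
    (h : GHDist X Y = 0) {ε : ℝ} (hε : 0 < ε) :
    ∃ R : Set (X × Y), IsCorrespondence R ∧
      ∀ p ∈ R, ∀ q ∈ R, |dist p.1 q.1 - dist p.2 q.2| < ε := by
  have h0 : (⨅ R : {R : Set (X × Y) // IsCorrespondence R}, distortion R.1) = 0 := by
    simpa [GHDist, ENNReal.div_eq_zero_iff] using h
  have h1 : (⨅ R : {R : Set (X × Y) // IsCorrespondence R}, distortion R.1)
      < ENNReal.ofReal ε := by
    rw [h0]; exact ENNReal.ofReal_pos.2 hε
  obtain ⟨⟨R, hR⟩, hlt⟩ := iInf_lt_iff.1 h1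
  refine ⟨R, hR, fun p hp q hq => ?_⟩
  have hle : ENNReal.ofReal |dist p.1 q.1 - dist p.2 q.2| ≤ distortion R :=
    (le_iSup₂ (f := fun q (_ : q ∈ R) => ENNReal.ofReal |dist p.1 q.1 - dist p.2 q.2|) q hq).trans
      (le_iSup₂ (f := fun p (_ : p ∈ R) => ⨆ q ∈ R,
        ENNReal.ofReal |dist p.1 q.1 - dist p.2 q.2|) p hp)
  exact (ENNReal.ofReal_lt_ofReal_iff hε).1 (hle.trans_lt hlt)

section HedgehogDist

variable {A : Type*} {f : A → ℝ}

theorem hedgehogDist_self (a : Option A) : hedgehogDist f a a = 0 := by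
  cases a <;> simp [hedgehogDist]

/-- Every geodesic between distinct points of a hedgehog passes through the center. -/
theorem hedgehogDist_of_ne {a b : Option A} (hab : a ≠ b) :
    hedgehogDist f a b = hedgehogDist f none a + hedgehogDist f none b := by
  rcases a with _ | a <;> rcases b with _ | b <;> simp_all [hedgehogDist]

theorem hedgehogDist_none_nonneg (hf : ∀ a, 0 < f a) (a : Option A) :
    0 ≤ hedgehogDist f none a := by
  cases a with
  | none => exact le_rfl
  | some a => exact (hf a).le

theorem hedgehogDist_le (hf : ∀ a, 0 < f a) (a b : Option A) :
    hedgehogDist f a b ≤ hedgehogDist f none a + hedgehogDist f none b := by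
  by_cases hab : a = b
  · subst hab
    rw [hedgehogDist_self]
    linarith [hedgehogDist_none_nonneg hf a]
  · exact (hedgehogDist_of_ne hab).le

variable {T : Type*} [MetricSpace T]

/-- Two correspondences of small distortion with a hedgehog having at least two needles relate
nearby points to the center. -/
theorem dist_lt_of_center {δ : ℝ} (hf : ∀ a, 0 < f a) {x y : A} (hxy : x ≠ y)
    (hx : 2 * δ ≤ f x) (hy : 2 * δ ≤ f y) {R R' : Set (T × Option A)}
    (hR : IsCorrespondence R) (hR' : IsCorrespondence R')
    (hd : ∀ p ∈ R, ∀ q ∈ R, |dist p.1 q.1 - hedgehogDist f p.2 q.2| < δ)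
    (hd' : ∀ p ∈ R', ∀ q ∈ R', |dist p.1 q.1 - hedgehogDist f p.2 q.2| < δ)
    {c c' : T} (hc : (c, none) ∈ R) (hc' : (c', none) ∈ R') : dist c c' < 4 * δ := by
  obtain ⟨t, ht⟩ := hR.2 (some x)
  obtain ⟨s, hs⟩ := hR.2 (some y)
  obtain ⟨q, hq⟩ := hR'.1 t
  obtain ⟨r, hr⟩ := hR'.1 s
  obtain ⟨p, hp⟩ := hR'.1 c
  have hct := abs_lt.1 (hd _ hc _ ht)
  have hcs := abs_lt.1 (hd _ hc _ hs)
  have hts := abs_lt.1 (hd _ ht _ hs)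
  have hct' := abs_lt.1 (hd' _ hp _ hq)
  have hcs' := abs_lt.1 (hd' _ hp _ hr)
  have hts' := abs_lt.1 (hd' _ hq _ hr)
  have hcc := abs_lt.1 (hd' _ hc' _ hp)
  have hpq : p ≠ q := by
    rintro rfl
    simp only [hedgehogDist_self] at hct'
    simp only [hedgehogDist] at hct
    linarith [hct.1, hct'.2]
  have hpr : p ≠ r := by
    rintro rfl
    simp only [hedgehogDist_self] at hcs'
    simp only [hedgehogDist] at hcs
    linarith [hcs.1, hcs'.2]
  have hqr := hedgehogDist_le hf q r
  simp only [hedgehogDist_of_ne hpq, hedgehogDist_of_ne hpr] at hct' hcs'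
  rw [hedgehogDist_of_ne (Option.some_injective A |>.ne hxy)] at hts
  rw [dist_comm c c']
  linarith [hct.2, hcs.2, hts.1, hct'.1, hcs'.1, hts'.2, hcc.2]

/-- A complete space approximated by a hedgehog has a point playing the role of the center. -/
theorem exists_approximate_center [CompleteSpace T] [Nonempty T]
    (hf : ∀ a, 0 < f a)
    (h : ∀ ε > 0, ∃ R : Set (T × Option A), IsCorrespondence R ∧
      ∀ p ∈ R, ∀ q ∈ R, |dist p.1 q.1 - hedgehogDist f p.2 q.2| < ε) :
    ∃ c : T, ∀ ε > 0, ∃ φ : T → Option A,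
      (∀ s t, |dist s t - hedgehogDist f (φ s) (φ t)| < ε) ∧
      ∀ t, |dist c t - hedgehogDist f none (φ t)| < ε := by
  rcases subsingleton_or_nontrivial A with hA | ⟨x, y, hxy⟩
  · obtain ⟨c⟩ := ‹Nonempty T›
    refine ⟨c, fun ε hε => ?_⟩
    obtain ⟨R, hR, hd⟩ := h ε hε
    choose φ hφ using hR.1
    have hφd : ∀ s t, |dist s t - hedgehogDist f (φ s) (φ t)| < ε :=
      fun s t => hd _ (hφ s) _ (hφ t)
    cases hc : φ c with
    | none => exact ⟨φ, hφd, fun t => hc ▸ hφd c t⟩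
    | some x =>
      classical
      have hswap : ∀ a b : Option A, hedgehogDist f (Equiv.swap none (some x) a)
          (Equiv.swap none (some x) b) = hedgehogDist f a b := by
        rintro (_ | a) (_ | b)
        · simp [hedgehogDist]
        · simp [Subsingleton.elim b x, hedgehogDist]
        · simp [Subsingleton.elim a x, hedgehogDist]
        · simp [Subsingleton.elim a b, hedgehogDist_self]
      refine ⟨fun t => Equiv.swap none (some x) (φ t), fun s t => ?_, fun t => ?_⟩
      · rw [hswap]; exact hφd s t
      · have := hφd c t
        rwa [← hswap, hc, Equiv.swap_apply_right] at this
  · obtain ⟨m, hm, hmx, hmy⟩ : ∃ m > 0, 2 * m ≤ f x ∧ 2 * m ≤ f y :=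
      ⟨min (f x) (f y) / 2, half_pos (lt_min (hf x) (hf y)),
        by linarith [min_le_left (f x) (f y)], by linarith [min_le_right (f x) (f y)]⟩
    let δ : ℕ → ℝ := fun n => m * (1 / ((n : ℝ) + 1))
    have hδ : ∀ n, 0 < δ n := fun n => mul_pos hm Nat.one_div_pos_of_nat
    have hδanti : ∀ {N n}, N ≤ n → δ n ≤ δ N := fun hn =>
      mul_le_mul_of_nonneg_left (Nat.one_div_le_one_div hn) hm.le
    have hδm : ∀ n, δ n ≤ m := fun n => by
      simpa [δ] using hδanti (Nat.zero_le n)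
    have hδ0 : Filter.Tendsto δ Filter.atTop (nhds 0) := by
      simpa [δ] using (tendsto_one_div_add_atTop_nhds_zero_nat (𝕜 := ℝ)).const_mul m
    choose R hR hd using fun n => h (δ n) (hδ n)
    choose c hc using fun n => (hR n).2 none
    have hcauchy : CauchySeq c := by
      refine cauchySeq_of_le_tendsto_0 (fun N => 4 * δ N) (fun n k N hn hk => ?_)
        (by simpa using hδ0.const_mul 4)
      exact (dist_lt_of_center hf hxy (by linarith [hδm N]) (by linarith [hδm N]) (hR n) (hR k)
        (fun p hp q hq => (hd n p hp q hq).trans_le (hδanti hn))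
        (fun p hp q hq => (hd k p hp q hq).trans_le (hδanti hk)) (hc n) (hc k)).le
    obtain ⟨z, hz⟩ := cauchySeq_tendsto_of_complete hcauchy
    refine ⟨z, fun ε hε => ?_⟩
    obtain ⟨n, hn, hzn⟩ := ((hδ0.eventually_lt_const (half_pos hε)).and
      (Metric.tendsto_nhds.1 hz (ε / 2) (half_pos hε))).exists
    choose φ hφ using (hR n).1
    refine ⟨φ, fun s t => (hd n _ (hφ s) _ (hφ t)).trans (by linarith), fun t => ?_⟩
    have h1 := abs_lt.1 (hd n _ (hc n) _ (hφ t))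
    have h2 := abs_le.1 (abs_dist_sub_le z (c n) t)
    rw [dist_comm] at hzn
    rw [abs_lt]
    constructor <;> linarith [h1.1, h1.2, h2.1, h2.2]

/-- Distinct points other than an approximate center are joined through it. -/
theorem dist_eq_add_of_approximate_center {c : T}
    (h : ∀ ε > 0, ∃ φ : T → Option A,
      (∀ s t, |dist s t - hedgehogDist f (φ s) (φ t)| < ε) ∧
      ∀ t, |dist c t - hedgehogDist f none (φ t)| < ε) {s t : T} (hst : s ≠ t) :
    dist s t = dist c s + dist c t := by
  refine eq_of_abs_sub_le_all fun ε hε => ?_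
  obtain ⟨φ, hφ, hcφ⟩ := h (min (ε / 3) (dist s t)) (lt_min (by positivity) (dist_pos.2 hst))
  have hne : φ s ≠ φ t := fun he => by
    have := hφ s t
    rw [he, hedgehogDist_self, sub_zero, abs_of_nonneg dist_nonneg] at this
    exact this.not_ge (min_le_right _ _)
  have h1 := abs_lt.1 (hφ s t)
  have h2 := abs_lt.1 (hcφ s)
  have h3 := abs_lt.1 (hcφ t)
  rw [hedgehogDist_of_ne hne] at h1
  have := min_le_left (ε / 3) (dist s t)
  rw [abs_le]
  constructor <;> linarith [h1.1, h1.2, h2.1, h2.2, h3.1, h3.2]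

/-- Distances to an approximate center are limits of needle lengths. -/
theorem dist_mem_closure_of_approximate_center {c : T}
    (h : ∀ ε > 0, ∃ φ : T → Option A,
      (∀ s t, |dist s t - hedgehogDist f (φ s) (φ t)| < ε) ∧
      ∀ t, |dist c t - hedgehogDist f none (φ t)| < ε) {t : T} (ht : t ≠ c) :
    dist c t ∈ closure (Set.range f) := by
  refine Metric.mem_closure_iff.2 fun ε hε => ?_
  obtain ⟨φ, -, hφ⟩ := h (min ε (dist c t)) (lt_min hε (dist_pos.2 ht.symm))
  have := hφ t
  cases ha : φ t with
  | none =>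
    rw [ha, hedgehogDist_self, sub_zero, abs_of_nonneg dist_nonneg] at this
    exact absurd this (min_le_right _ _).not_gt
  | some a =>
    rw [ha] at this
    exact ⟨f a, ⟨a, rfl⟩, this.trans_le (min_le_left _ _)⟩

end HedgehogDist

/-- A complete metric space at zero Gromov–Hausdorff distance from a hedgehog is
isometric to a hedgehog over a set with multiplicities whose needle lengths lie in
the closure of the original set. -/
theorem complete_zero_dist_from_hedgehog {T : Type u} [mT : MetricSpace T] [Nonempty T]
    [CompleteSpace T] (X : Set ℝ) (hX : X ⊆ Set.Ioi 0) (hXne : X.Nonempty)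
    (h : @GHDist T (Option ↥X) mT (hedgehogSet X hX) = 0) :
    ∃ (A : Type u) (f : A → ℝ) (hf : ∀ a, 0 < f a),
      Set.range f ⊆ closure X ∧ IsometricM mT (hedgehog f hf) := by
  have hX0 : ∀ x : X, 0 < (x : ℝ) := fun x => hX x.2
  obtain ⟨c, hc⟩ := exists_approximate_center (T := T) hX0 fun ε hε =>
    @exists_correspondence_of_GHDist_eq_zero T (Option X) mT (hedgehogSet X hX) h ε hε
  refine ⟨{t : T // t ≠ c}, fun t => dist c t, fun t => dist_pos.2 t.2.symm, ?_, ?_⟩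
  · rintro _ ⟨t, rfl⟩
    simpa using dist_mem_closure_of_approximate_center hc t.2
  · classical
    refine ⟨(Equiv.optionSubtypeNe c).symm, fun a b => ?_⟩
    obtain ⟨a, rfl⟩ := (Equiv.optionSubtypeNe c).surjective a
    obtain ⟨b, rfl⟩ := (Equiv.optionSubtypeNe c).surjective b
    rw [Equiv.symm_apply_apply, Equiv.symm_apply_apply]
    change hedgehogDist _ a b = _
    rcases a with _ | a <;> rcases b with _ | b
    · simp [hedgehogDist]
    · simp [hedgehogDist]
    · simp [hedgehogDist, dist_comm]
    · by_cases hab : a = b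
      · simp [hedgehogDist, hab]
      · simpa [hedgehogDist, hab] using
          (dist_eq_add_of_approximate_center hc (Subtype.coe_injective.ne hab)).symm
end

section
/- There exists a family (Y_S) of nonempty complete metric spaces indexed by the subsets S of ℝ, pairwise non-isometric (Y_S is not isometric to Y_{S'} for S ≠ S'), such that dGH(Y_S, R̂₊) = 0 for every S, where R̂₊ denotes the hedgehog over (0,∞). (Hence there exist 2^𝔠 pairwise non-isometric complete metric spaces at zero Gromov–Hausdorff distance from R̂₊.) -/
set_option linter.unusedVariables false
set_option linter.unreachableTactic false
set_option linter.unusedTactic false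

open scoped ENNReal

/-- The distance from a point of a hedgehog to the center is at most its distance to any other
point. -/
theorem hedgehogDist_none_le_of_ne {A : Type*} {f : A → ℝ} (hf : ∀ a, 0 < f a) {x y : Option A}
    (hxy : x ≠ y) : hedgehogDist f x none ≤ hedgehogDist f x y := by
  rcases x with _ | a <;> rcases y with _ | b
  · exact absurd rfl hxy
  · exact (hf b).le
  · exact le_rfl
  · have hab : a ≠ b := fun h => hxy (congrArg some h)
    simp only [hedgehogDist, if_neg hab]
    linarith [hf b]

theorem hedgehog_completeSpace {A : Type*} (f : A → ℝ) (hf : ∀ a, 0 < f a) :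
    @CompleteSpace (Option A) (hedgehog f hf).toPseudoMetricSpace.toUniformSpace := by
  let := hedgehog f hf
  have key : ∀ {x y : Option A}, x ≠ y → dist x none ≤ dist x y :=
    fun h => hedgehogDist_none_le_of_ne hf h
  refine Metric.complete_of_cauchySeq_tendsto fun u hu => ?_
  by_cases h : ∀ δ > 0, ∃ N, ∀ n ≥ N, dist (u n) none < δ
  · exact ⟨none, Metric.tendsto_atTop.2 h⟩
  · push Not at h
    obtain ⟨δ, hδ, h⟩ := h
    obtain ⟨N, hN⟩ := Metric.cauchySeq_iff.1 hu δ hδ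
    obtain ⟨n, hn, hle⟩ := h N
    refine ⟨u n, tendsto_atTop_of_eventually_const (i₀ := N) fun m hm => ?_⟩
    by_contra hne
    exact absurd (hN n hn m hm) (not_lt.2 (hle.trans (key (Ne.symm hne))))

theorem abs_hedgehogDist_sub_le {A B : Type*} {f : A → ℝ} {g : B → ℝ} (e : A ≃ B) {ε : ℝ}
    (hε : 0 ≤ ε) (h : ∀ a, |f a - g (e a)| ≤ ε) (x y : Option A) :
    |hedgehogDist f x y - hedgehogDist g (x.map e) (y.map e)| ≤ 2 * ε := by
  rcases x with _ | a <;> rcases y with _ | b <;>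
    simp only [hedgehogDist, Option.map_none, Option.map_some]
  · simpa using hε
  · linarith [h b]
  · linarith [h a]
  · by_cases hab : a = b
    · simpa [hab] using hε
    · rw [if_neg hab, if_neg (e.injective.ne hab)]
      have ha := abs_le.1 (h a)
      have hb := abs_le.1 (h b)
      exact abs_le.2 ⟨by linarith [ha.1, hb.1], by linarith [ha.2, hb.2]⟩

/-- Hedgehogs whose needles can be matched bijectively with arbitrarily small change of length are
at zero Gromov–Hausdorff distance. -/
theorem GHDist_hedgehog_eq_zero {A B : Type*} {f : A → ℝ} {g : B → ℝ} (hf : ∀ a, 0 < f a)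
    (hg : ∀ b, 0 < g b) (h : ∀ ε > 0, ∃ e : A ≃ B, ∀ a, |f a - g (e a)| ≤ ε) :
    @GHDist (Option A) (Option B) (hedgehog f hf) (hedgehog g hg) = 0 := by
  let := hedgehog f hf
  let := hedgehog g hg
  have hinf : (⨅ R : {R : Set (Option A × Option B) // IsCorrespondence R}, distortion R.1) = 0 := by
    refine le_antisymm (ENNReal.le_of_forall_pos_le_add fun ε hε _ => ?_) bot_le
    obtain ⟨e, he⟩ := h (ε / 2) (by positivity)
    let E := Equiv.optionCongr e
    refine (iInf_le _ ⟨{p | E p.1 = p.2}, fun x => ⟨E x, rfl⟩,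
      fun y => ⟨E.symm y, E.apply_symm_apply y⟩⟩).trans ?_
    rw [zero_add]
    refine iSup₂_le fun p hp => iSup₂_le fun q hq => ?_
    obtain ⟨x, _⟩ := p
    obtain ⟨y, _⟩ := q
    obtain rfl : E x = _ := hp
    obtain rfl : E y = _ := hq
    refine ENNReal.ofReal_le_of_le_toReal ?_
    have := abs_hedgehogDist_sub_le e (by positivity) he x y
    rw [ENNReal.coe_toReal]
    linarith!
  rw [GHDist, hinf, ENNReal.zero_div]

/-- A distance-preserving bijection between hedgehogs preserves the center, provided the target has
at least two needles. -/
theorem hedgehog_isometry_map_none {A B : Type*} [Nontrivial B] {f : A → ℝ} {g : B → ℝ}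
    (hg : ∀ b, 0 < g b) (φ : Option A ≃ Option B)
    (hφ : ∀ x y, hedgehogDist g (φ x) (φ y) = hedgehogDist f x y) : φ none = none := by
  rcases hc : φ none with _ | t
  · rfl
  obtain ⟨b, hb⟩ := exists_ne t
  have tip : ∀ z, z ≠ some t → ∃ a, φ (some a) = z := fun z hz => by
    rcases hx : φ.symm z with _ | a
    · rw [Equiv.symm_apply_eq] at hx
      exact absurd (hx.trans hc) hz
    · exact ⟨a, ((Equiv.symm_apply_eq φ).1 hx).symm⟩
  obtain ⟨a₀, h₀⟩ := tip none (by simp)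
  obtain ⟨a₁, h₁⟩ := tip (some b) (by simpa using hb)
  have hne : a₀ ≠ a₁ := by
    rintro rfl
    simp [h₀] at h₁
  have e₀ := hφ none (some a₀)
  have e₁ := hφ none (some a₁)
  have e₂ := hφ (some a₀) (some a₁)
  rw [hc, h₀] at e₀
  rw [hc, h₁] at e₁
  rw [h₀, h₁] at e₂
  simp only [hedgehogDist, if_neg hne, if_neg hb.symm] at e₀ e₁ e₂
  linarith [hg t]

open Cardinal in
/-- If the needle lengths in `A` contain every positive real and `A` has at most continuum many
needles, the needles falling in each interval of a grid are continuum many, or none for the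
degenerate interval. -/
theorem mk_natCeil_fiber {A : Type} {f : A → ℝ} (hf : ∀ a, 0 < f a) (hA : #A ≤ 𝔠)
    (i : Set.Ioi (0 : ℝ) → A) (hi : ∀ x, f (i x) = x) {ε : ℝ} (hε : 0 < ε) (k : ℕ) :
    #{a // ⌈f a / ε⌉₊ = k} = if k = 0 then 0 else 𝔠 := by
  split_ifs with hk
  · refine mk_eq_zero_iff.2 ⟨fun ⟨a, ha⟩ => ?_⟩
    rw [hk, Nat.ceil_eq_zero] at ha
    exact absurd (div_pos (hf a) hε) (not_lt.2 ha)
  · refine le_antisymm ((mk_subtype_le _).trans hA) ?_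
    have hk1 : (1 : ℝ) ≤ k := by exact_mod_cast Nat.one_le_iff_ne_zero.2 hk
    have hlt : ((k : ℝ) - 1) * ε < k * ε := by nlinarith
    rw [← mk_Ioc_real hlt]
    have hpos : ∀ x : Set.Ioc (((k : ℝ) - 1) * ε) (k * ε), 0 < (x : ℝ) := fun x =>
      (mul_nonneg (by linarith) hε.le).trans_lt x.2.1
    refine mk_le_of_injective (f := fun x => ⟨i ⟨x, hpos x⟩, ?_⟩) fun x y hxy => ?_
    · rw [hi, Nat.ceil_eq_iff hk, lt_div_iff₀ hε, div_le_iff₀ hε,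
        Nat.cast_sub (Nat.one_le_iff_ne_zero.2 hk), Nat.cast_one]
      exact x.2
    · have := congrArg f (Subtype.ext_iff.1 hxy)
      rw [hi, hi] at this
      exact Subtype.ext this

theorem abs_sub_le_of_natCeil_div_eq {x y ε : ℝ} (hx : 0 < x) (hy : 0 < y) (hε : 0 < ε)
    (h : ⌈x / ε⌉₊ = ⌈y / ε⌉₊) : |x - y| ≤ ε := by
  have hx₁ := Nat.le_ceil (x / ε)
  have hx₂ := Nat.ceil_lt_add_one (div_pos hx hε).le
  have hy₁ := Nat.le_ceil (y / ε)
  have hy₂ := Nat.ceil_lt_add_one (div_pos hy hε).le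
  rw [h] at hx₁ hx₂
  have hd : |x / ε - y / ε| ≤ 1 := abs_le.2 ⟨by linarith, by linarith⟩
  rwa [← sub_div, abs_div, abs_of_pos hε, div_le_one hε] at hd

/-- Two maps with equinumerous fibers differ by a bijection of their domains. -/
theorem exists_equiv_of_mk_fiber_eq {A B : Type} {ι : Type*} (f : A → ι) (g : B → ι)
    (h : ∀ k, Cardinal.mk {a // f a = k} = Cardinal.mk {b // g b = k}) :
    ∃ e : A ≃ B, ∀ a, g (e a) = f a := by
  let e k := (Cardinal.eq.1 (h k)).some
  exact ⟨(Equiv.sigmaFiberEquiv f).symm.trans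
    ((Equiv.sigmaCongrRight e).trans (Equiv.sigmaFiberEquiv g)), fun a => (e (f a) ⟨a, rfl⟩).2⟩

/-- One needle of each positive length, and an additional needle of length `exp s` for each
`s ∈ S`. -/
noncomputable def doubledLength (S : Set ℝ) : Set.Ioi (0 : ℝ) ⊕ S → ℝ :=
  Sum.elim (fun x => x) (fun s => Real.exp s)

theorem doubledLength_pos (S : Set ℝ) (a : Set.Ioi (0 : ℝ) ⊕ S) : 0 < doubledLength S a := by
  rcases a with x | s
  · exact x.2
  · exact Real.exp_pos _

theorem mem_iff_exists_doubledLength_eq (S : Set ℝ) (r : ℝ) :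
    r ∈ S ↔ ∃ a b, a ≠ b ∧ doubledLength S a = Real.exp r ∧ doubledLength S b = Real.exp r := by
  constructor
  · exact fun hr => ⟨.inl ⟨Real.exp r, Real.exp_pos r⟩, .inr ⟨r, hr⟩, by simp, rfl, rfl⟩
  · rintro ⟨a, b, hab, ha, hb⟩
    rcases a with x | s
    · rcases b with y | s
      · exact absurd (congrArg Sum.inl (Subtype.ext (ha.trans hb.symm))) hab
      · exact Real.exp_injective hb ▸ s.2
    · exact Real.exp_injective ha ▸ s.2

theorem subset_of_isometricM {S S' : Set ℝ}
    (h : IsometricM (hedgehog (doubledLength S) (doubledLength_pos S))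
      (hedgehog (doubledLength S') (doubledLength_pos S'))) : S ⊆ S' := by
  obtain ⟨φ, hφ⟩ := h
  replace hφ : ∀ x y, hedgehogDist (doubledLength S') (φ x) (φ y) =
    hedgehogDist (doubledLength S) x y := hφ
  have : Nontrivial (Set.Ioi (0 : ℝ) ⊕ S') :=
    ⟨.inl ⟨1, by simp⟩, .inl ⟨2, by simp⟩, by simp⟩
  have hc := hedgehog_isometry_map_none (doubledLength_pos S') φ hφ
  have tip : ∀ a, ∃ a', φ (some a) = some a' ∧ doubledLength S' a' = doubledLength S a := by
    intro a
    rcases ha : φ (some a) with _ | a'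
    · exact absurd (φ.injective (ha.trans hc.symm)) (by simp)
    · have := hφ none (some a)
      rw [hc, ha] at this
      exact ⟨a', rfl, this⟩
  intro r hr
  obtain ⟨a, b, hab, ha, hb⟩ := (mem_iff_exists_doubledLength_eq S r).1 hr
  obtain ⟨a', ha', hla⟩ := tip a
  obtain ⟨b', hb', hlb⟩ := tip b
  refine (mem_iff_exists_doubledLength_eq S' r).2
    ⟨a', b', ?_, hla.trans ha, hlb.trans hb⟩
  rintro rfl
  exact hab (Option.some_injective _ (φ.injective (ha'.trans hb'.symm)))

theorem IsometricM.symm {X Y : Type*} {mX : MetricSpace X} {mY : MetricSpace Y}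
    (h : IsometricM mX mY) : IsometricM mY mX := by
  obtain ⟨φ, hφ⟩ := h
  exact ⟨φ.symm, fun a b => by rw [← hφ, φ.apply_symm_apply, φ.apply_symm_apply]⟩

open Cardinal in
theorem GHDist_doubled_eq_zero (S : Set ℝ) :
    @GHDist (Option (Set.Ioi (0 : ℝ) ⊕ S)) (Option (Set.Ioi (0 : ℝ)))
      (hedgehog (doubledLength S) (doubledLength_pos S))
      (hedgehogSet (Set.Ioi 0) subset_rfl) = 0 := by
  refine GHDist_hedgehog_eq_zero _ _ fun ε hε => ?_
  have hcard : #(Set.Ioi (0 : ℝ) ⊕ S) ≤ 𝔠 := by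
    rw [mk_sum, lift_id, lift_id, mk_Ioi_real]
    exact add_le_of_le aleph0_le_continuum le_rfl ((mk_set_le S).trans mk_real.le)
  obtain ⟨e, he⟩ := exists_equiv_of_mk_fiber_eq (fun a => ⌈doubledLength S a / ε⌉₊)
    (fun x : Set.Ioi (0 : ℝ) => ⌈(x : ℝ) / ε⌉₊) fun k => by
      rw [mk_natCeil_fiber (doubledLength_pos S) hcard Sum.inl (fun _ => rfl) hε k]
      exact (mk_natCeil_fiber (f := fun x : Set.Ioi (0 : ℝ) => (x : ℝ)) (fun x => x.2)
        (mk_Ioi_real 0).le id (fun _ => rfl) hε k).symm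
  exact ⟨e, fun a => abs_sub_le_of_natCeil_div_eq (doubledLength_pos S a) (e a).2 hε (he a).symm⟩

/-- There is a family of pairwise non-isometric nonempty complete metric spaces,
indexed by the subsets of `ℝ` (hence of cardinality `2 ^ 𝔠`), all at zero
Gromov–Hausdorff distance from the hedgehog over `(0,∞)`. -/
theorem two_pow_continuum_spaces_zero_dist_from_Rpos :
    ∃ (Y : Set ℝ → Type) (mY : ∀ S, MetricSpace (Y S)),
      (∀ S, Nonempty (Y S)) ∧
      (∀ S, @CompleteSpace (Y S) (mY S).toPseudoMetricSpace.toUniformSpace) ∧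
      (∀ S S' : Set ℝ, S ≠ S' → ¬ IsometricM (mY S) (mY S')) ∧
      (∀ S, @GHDist (Y S) (Option ↥(Set.Ioi (0 : ℝ))) (mY S)
        (hedgehogSet (Set.Ioi 0) subset_rfl) = 0) := by
  refine ⟨fun S => Option (Set.Ioi (0 : ℝ) ⊕ S),
    fun S => hedgehog (doubledLength S) (doubledLength_pos S), fun _ => ⟨none⟩,
    fun S => hedgehog_completeSpace _ _, fun S S' hne h => hne ?_, GHDist_doubled_eq_zero⟩
  exact (subset_of_isometricM h).antisymm (subset_of_isometricM h.symm)
end
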